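/- arXiv:2603.00417 — 2 statements merged into one kernel-verified Lean document; each statement's English description precedes it below -/
import Mathlib

section
/- Let X be a set and let ℱ be a union bounded family of finite subsets of X. If ℱ is (1/3, 1/3)-EMX learnable over the class of finitely supported probability distributions on X, then there exists m ∈ ℕ such that ℱ admits an (m+1) → m monotone compression scheme. In fact, if a learner with sample size d achieves the (1/3,1/3) guarantee, then m = ⌈3d/2⌉ suffices. -/
open scoped ENNReal

/-- An `m → d` monotone compression scheme for a family `ℱ` of finite subsets of `X`. -/
def MonotoneCompression {X : Type*} (ℱ : Set (Finset X)) (m d : ℕ) : Prop :=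
  ∃ η : (Fin d → X) → Finset X, (∀ s, η s ∈ ℱ) ∧
    ∀ F ∈ ℱ, ∀ x : Fin m → X, (∀ j, x j ∈ F) →
      ∃ ι : Fin d → Fin m, StrictMono ι ∧ ∀ j, x j ∈ η (x ∘ ι)

/-- `ℱ` is union bounded if any two members are jointly contained in a third member. -/
def UnionBounded {X : Type*} (ℱ : Set (Finset X)) : Prop :=
  ∀ F₁ ∈ ℱ, ∀ F₂ ∈ ℱ, ∃ F₃ ∈ ℱ, F₁ ⊆ F₃ ∧ F₂ ⊆ F₃

/-- The probability, under the i.i.d. product of `d` copies of `P`, of the event `E`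
of `d`-tuples of samples. -/
noncomputable def iidProb {X : Type*} {d : ℕ} (P : PMF X) (E : Set (Fin d → X)) : ℝ≥0∞ :=
  ∑' s : Fin d → X, Set.indicator E (fun s => ∏ i, P (s i)) s

/-- `opt_ℱ(P) = sup_{F ∈ ℱ} P(F)`. -/
noncomputable def emxOpt {X : Type*} (ℱ : Set (Finset X)) (P : PMF X) : ℝ≥0∞ :=
  ⨆ F ∈ ℱ, P.toOuterMeasure (F : Set X)

/-- `(ε,δ)`-EMX learnability of `ℱ` over finitely supported distributions: some proper
learner `G` on samples of some fixed size `d` outputs, with `P^d`-probability at least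
`1 - δ`, a member of `ℱ` capturing `P`-mass at least `opt_ℱ(P) - ε`. -/
def EMXLearnable {X : Type*} (ℱ : Set (Finset X)) (ε δ : ℝ≥0∞) : Prop :=
  ∃ (d : ℕ) (G : (Fin d → X) → Finset X), (∀ s, G s ∈ ℱ) ∧
    ∀ P : PMF X, P.support.Finite →
      1 - δ ≤ iidProb P {s | emxOpt ℱ P - ε ≤ P.toOuterMeasure ((G s : Set X))}

/-- A finite subfamily of a nonempty union bounded family has an upper bound in the family. -/
theorem UnionBounded.exists_forall_subset {X ι : Type*} [Finite ι] {ℱ : Set (Finset X)}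
    (hUB : UnionBounded ℱ) (hne : ℱ.Nonempty) (f : ι → Finset X) (hf : ∀ i, f i ∈ ℱ) :
    ∃ F ∈ ℱ, ∀ i, f i ⊆ F := by
  have : Nonempty ℱ := hne.to_subtype
  have hdir : Directed (· ≤ ·) (fun F : ℱ => F) := fun A B => by
    obtain ⟨C, hC, hA, hB⟩ := hUB A A.2 B B.2
    exact ⟨⟨C, hC⟩, hA, hB⟩
  obtain ⟨C, hC⟩ := hdir.finite_le (fun i => (⟨f i, hf i⟩ : ℱ))
  exact ⟨C, C.2, fun i => hC i⟩

/-- An event of positive probability contains a sample all of whose entries lie in the support. -/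
theorem exists_mem_of_iidProb_ne_zero {X : Type*} {d : ℕ} {P : PMF X} {E : Set (Fin d → X)}
    (h : iidProb P E ≠ 0) : ∃ s ∈ E, ∀ i, s i ∈ P.support := by
  rw [iidProb, Ne, ENNReal.tsum_eq_zero, not_forall] at h
  obtain ⟨s, hs⟩ := h
  rw [Set.indicator_apply_eq_zero, Classical.not_imp, Finset.prod_eq_zero_iff] at hs
  exact ⟨s, hs.1, fun i hi => hs.2 ⟨i, Finset.mem_univ i, hi⟩⟩

/-- If a learner for `ℱ` of sample size `d` succeeds with positive probability and error `1/3`,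
then among more than `3 * d / 2` distinct points of a member of `ℱ` there is one which the learner
captures from a sample of the remaining ones. -/
theorem exists_mem_learner_of_injective {X : Type*} {ℱ : Set (Finset X)} {d n : ℕ}
    {G : (Fin d → X) → Finset X}
    (hG : ∀ P : PMF X, P.support.Finite →
      iidProb P {s | emxOpt ℱ P - 1/3 ≤ P.toOuterMeasure ((G s : Set X))} ≠ 0)
    (hn : 3 * d < 2 * n) {F : Finset X} (hF : F ∈ ℱ) {x : Fin n → X}
    (hx : Function.Injective x) (hxF : ∀ j, x j ∈ F) :
    ∃ (i : Fin n) (g : Fin d → Fin n), (∀ j, g j ≠ i) ∧ x i ∈ G (x ∘ g) := by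
  classical
  have : NeZero n := ⟨by omega⟩
  set A : Finset X := Finset.univ.map ⟨x, hx⟩ with hA
  have hAne : A.Nonempty := Finset.univ_nonempty.map
  have hcard : A.card = n := by simp [hA]
  set P := PMF.uniformOfFinset A hAne with hP
  have hsupp : P.support = A := PMF.support_uniformOfFinset hAne
  obtain ⟨s, hs, hsA⟩ :=
    exists_mem_of_iidProb_ne_zero (hG P (by rw [hsupp]; exact A.finite_toSet))
  have hrange : ∀ i, ∃ j, x j = s i := fun i => by
    simpa [hsupp, hA] using hsA i
  choose g hg using hrange
  obtain rfl : x ∘ g = s := funext hg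
  by_contra! hbad
  have hopt : 1 ≤ emxOpt ℱ P := by
    refine le_trans (le_of_eq ?_)
      (le_iSup₂ (f := fun (F : Finset X) (_ : F ∈ ℱ) => P.toOuterMeasure (F : Set X)) F hF)
    refine ((PMF.toOuterMeasure_apply_eq_one_iff P _).2 ?_).symm
    rw [hsupp]
    intro y hy
    obtain ⟨j, -, rfl⟩ := Finset.mem_map.1 hy
    exact hxF j
  have hsub : A.filter (· ∈ (G (x ∘ g) : Set X)) ⊆ Finset.univ.image (x ∘ g) := by
    intro y hy
    obtain ⟨hyA, hyG⟩ := Finset.mem_filter.1 hy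
    obtain ⟨i, -, rfl⟩ := Finset.mem_map.1 hyA
    by_contra hi
    refine hbad i g (fun j hj => hi ?_) hyG
    exact Finset.mem_image.2 ⟨j, Finset.mem_univ j, congrArg x hj⟩
  have hle : (A.filter (· ∈ (G (x ∘ g) : Set X))).card ≤ d :=
    (Finset.card_le_card hsub).trans (Finset.card_image_le.trans (by simp))
  have hmass : (1 : ℝ≥0∞) - 1/3 ≤ d / n := by
    refine (tsub_le_tsub_right hopt _).trans (le_trans hs ?_)
    rw [hP, PMF.toOuterMeasure_uniformOfFinset_apply, hcard]
    exact ENNReal.div_le_div_right (Nat.cast_le.2 (by convert hle)) _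
  have hreal := ENNReal.toReal_mono
    (ENNReal.div_ne_top (ENNReal.natCast_ne_top d) (by simp [NeZero.ne n])) hmass
  rw [ENNReal.toReal_sub_of_le (by simp) (by simp)] at hreal
  simp only [ENNReal.toReal_div, ENNReal.toReal_one, ENNReal.toReal_ofNat,
    ENNReal.toReal_natCast] at hreal
  rw [le_div_iff₀ (by exact_mod_cast Nat.pos_of_neZero n)] at hreal
  have : (3 * d : ℝ) < 2 * n := by exact_mod_cast hn
  linarith

/-- A learner of sample size `d` with error `1/3` and positive success probability yields an
`(m + 1) → m` monotone compression scheme whenever `d ≤ m` and `3 * d < 2 * (m + 1)`. -/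
theorem UnionBounded.monotoneCompression {X : Type*} {ℱ : Set (Finset X)}
    (hUB : UnionBounded ℱ) {d m : ℕ} {G : (Fin d → X) → Finset X} (hGℱ : ∀ s, G s ∈ ℱ)
    (hG : ∀ P : PMF X, P.support.Finite →
      iidProb P {s | emxOpt ℱ P - 1/3 ≤ P.toOuterMeasure ((G s : Set X))} ≠ 0)
    (hdm : d ≤ m) (hm : 3 * d < 2 * (m + 1)) : MonotoneCompression ℱ (m + 1) m := by
  have hex : ∀ T : Fin m → X, ∃ H ∈ ℱ, (∀ f : Fin d → Fin m, G (T ∘ f) ⊆ H) ∧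
      ((∃ F ∈ ℱ, ∀ i, T i ∈ F) → ∀ i, T i ∈ H) := by
    intro T
    obtain ⟨H, hH, hGH⟩ := hUB.exists_forall_subset ⟨_, hGℱ (T ∘ Fin.castLE hdm)⟩
      (fun f : Fin d → Fin m => G (T ∘ f)) (fun _ => hGℱ _)
    by_cases hT : ∃ F ∈ ℱ, ∀ i, T i ∈ F
    · obtain ⟨F, hF, hTF⟩ := hT
      obtain ⟨K, hK, hHK, hFK⟩ := hUB H hH F hF
      exact ⟨K, hK, fun f => (hGH f).trans hHK, fun _ i => hFK (hTF i)⟩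
    · exact ⟨H, hH, hGH, fun h => absurd h hT⟩
  choose η hη hGη hTη using hex
  refine ⟨η, hη, fun F hF x hx => ?_⟩
  suffices h : ∃ i : Fin (m + 1), x i ∈ η (x ∘ i.succAbove) by
    obtain ⟨i, hi⟩ := h
    refine ⟨i.succAbove, Fin.strictMono_succAbove i, fun j => ?_⟩
    rcases Fin.eq_self_or_eq_succAbove i j with rfl | ⟨k, rfl⟩
    · exact hi
    · exact hTη (x ∘ i.succAbove) ⟨F, hF, fun _ => hx _⟩ k
  by_cases hinj : Function.Injective x
  · obtain ⟨i, g, hgi, hi⟩ := exists_mem_learner_of_injective hG hm hF hinj hx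
    choose f hf using fun j => Fin.exists_succAbove_eq (hgi j)
    obtain rfl : i.succAbove ∘ f = g := funext hf
    exact ⟨i, hGη (x ∘ i.succAbove) f hi⟩
  · obtain ⟨i, j, hij, hne⟩ := Function.not_injective_iff.1 hinj
    obtain ⟨k, rfl⟩ := Fin.exists_succAbove_eq hne.symm
    refine ⟨i, ?_⟩
    rw [hij]
    exact hTη (x ∘ i.succAbove) ⟨F, hF, fun _ => hx _⟩ k

/-- If a union bounded family `ℱ` of finite subsets of `X` is `(1/3, 1/3)`-EMX learnable
over finitely supported distributions, then it admits an `(m+1) → m` monotone compression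
scheme for some `m`; in fact, if a learner with sample size `d` achieves the `(1/3,1/3)`
guarantee, then `m = ⌈3d/2⌉` suffices. -/
theorem monotone_compression_of_emx_learnable {X : Type*} (ℱ : Set (Finset X))
    (hUB : UnionBounded ℱ) :
    (EMXLearnable ℱ (1/3) (1/3) → ∃ m : ℕ, MonotoneCompression ℱ (m + 1) m) ∧
    (∀ (d : ℕ) (G : (Fin d → X) → Finset X), (∀ s, G s ∈ ℱ) →
      (∀ P : PMF X, P.support.Finite →
        1 - (1/3 : ℝ≥0∞) ≤
          iidProb P {s | emxOpt ℱ P - 1/3 ≤ P.toOuterMeasure ((G s : Set X))}) →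
      MonotoneCompression ℱ ((3 * d + 1) / 2 + 1) ((3 * d + 1) / 2)) := by
  have key : ∀ (d : ℕ) (G : (Fin d → X) → Finset X), (∀ s, G s ∈ ℱ) →
      (∀ P : PMF X, P.support.Finite →
        1 - (1/3 : ℝ≥0∞) ≤
          iidProb P {s | emxOpt ℱ P - 1/3 ≤ P.toOuterMeasure ((G s : Set X))}) →
      MonotoneCompression ℱ ((3 * d + 1) / 2 + 1) ((3 * d + 1) / 2) := by
    intro d G hGℱ hG
    refine hUB.monotoneCompression hGℱ (fun P hP => ?_) (by omega) (by omega)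
    refine (lt_of_lt_of_le (tsub_pos_of_lt ?_) (hG P hP)).ne'
    simp
  refine ⟨?_, key⟩
  rintro ⟨d, G, hGℱ, hG⟩
  exact ⟨_, key d G hGℱ hG⟩
end

section
/- Let Y be a countable set and let π : X → Y be any map. Then the family ℱ_fin^{(π)} := {π⁻¹(F) : F ⊆ Y finite} is (1/3, 1/3)-learnable under coarse-grained access: there exist d ∈ ℕ and a function G : Y^d → ℱ_fin^{(π)} such that for every finitely supported probability distribution P on X, the probability under the i.i.d. product P^d that a sample (x₁,…,x_d) satisfies P(G(π(x₁),…,π(x_d))) ≥ opt_{ℱ_fin^{(π)}}(P) − 1/3 is at least 2/3. -/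
open scoped ENNReal

/-- `opt_ℱ(P) = sup_{F ∈ ℱ} P(F)` for a family `ℱ` of subsets. -/
noncomputable def optFam {X : Type*} (ℱ : Set (Set X)) (P : PMF X) : ℝ≥0∞ :=
  ⨆ F ∈ ℱ, P.toOuterMeasure F

/-- The finite-precision finite-subset class `ℱ_fin^{(π)} = {π⁻¹(F) : F ⊆ Y finite}`. -/
def finPrecisionClass {X Y : Type*} (π : X → Y) : Set (Set X) :=
  {A : Set X | ∃ F : Finset Y, A = π ⁻¹' (F : Set Y)}

theorem ENNReal.tsum_pi_fin_prod {X : Type*} (f : X → ℝ≥0∞) (d : ℕ) :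
    ∑' s : Fin d → X, ∏ i, f (s i) = (∑' x, f x) ^ d := by
  induction d with
  | zero => simp
  | succ d ih =>
    rw [← (Fin.consEquiv fun _ : Fin (d + 1) => X).tsum_eq, ENNReal.tsum_prod']
    simp only [Fin.consEquiv_apply, Fin.prod_univ_succ, Fin.cons_zero, Fin.cons_succ,
      ENNReal.tsum_mul_left, ih, ENNReal.tsum_mul_right]
    rw [pow_succ']

theorem iidProb_mono {X : Type*} {d : ℕ} (P : PMF X) {E E' : Set (Fin d → X)} (h : E ⊆ E') :
    iidProb P E ≤ iidProb P E' :=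
  ENNReal.tsum_le_tsum fun s => Set.indicator_le_indicator_of_subset h (fun _ => zero_le) s

theorem iidProb_add_compl {X : Type*} {d : ℕ} (P : PMF X) (E : Set (Fin d → X)) :
    iidProb P E + iidProb P Eᶜ = 1 := by
  unfold iidProb
  rw [← ENNReal.tsum_add]
  simp only [Set.indicator_self_add_compl_apply]
  rw [ENNReal.tsum_pi_fin_prod, P.tsum_coe, one_pow]

theorem iidProb_forall_mem {X : Type*} (d : ℕ) (P : PMF X) (B : Set X) :
    iidProb P {S : Fin d → X | ∀ j, S j ∈ B} = P.toOuterMeasure B ^ d := by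
  classical
  rw [PMF.toOuterMeasure_apply, ← ENNReal.tsum_pi_fin_prod, iidProb]
  refine tsum_congr fun s => ?_
  by_cases h : ∀ j, s j ∈ B
  · rw [Set.indicator_of_mem (by exact h)]
    exact Finset.prod_congr rfl fun j _ => (Set.indicator_of_mem (h j) _).symm
  · rw [Set.indicator_of_notMem (by exact h)]
    obtain ⟨j, hj⟩ := not_forall.mp h
    exact (Finset.prod_eq_zero (Finset.mem_univ j) (Set.indicator_of_notMem hj _)).symm

theorem PMF.toOuterMeasure_le_one {X : Type*} (P : PMF X) (A : Set X) :
    P.toOuterMeasure A ≤ 1 :=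
  (P.toOuterMeasure.mono (Set.subset_univ A)).trans
    ((P.toOuterMeasure_apply_eq_one_iff _).mpr (Set.subset_univ _)).le

theorem optFam_le_one {X : Type*} (ℱ : Set (Set X)) (P : PMF X) : optFam ℱ P ≤ 1 :=
  iSup₂_le fun F _ => P.toOuterMeasure_le_one F

/-- A quantile of a finitely supported law along `f : X → ℕ`. -/
theorem PMF.exists_quantile {X : Type*} (P : PMF X) (hP : P.support.Finite) (f : X → ℕ)
    {c : ℝ≥0∞} (hc₀ : 0 < c) (hc₁ : c ≤ 1) :
    ∃ m, P.toOuterMeasure {x | f x < m} < c ∧ c ≤ P.toOuterMeasure {x | f x ≤ m} := by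
  classical
  have hex : ∃ k, c ≤ P.toOuterMeasure {x | f x < k} := by
    obtain ⟨b, hb⟩ := (hP.image f).bddAbove
    refine ⟨b + 1, hc₁.trans ((P.toOuterMeasure_apply_eq_one_iff _).mpr fun x hx => ?_).ge⟩
    exact Nat.lt_succ_of_le (hb ⟨x, hx, rfl⟩)
  obtain ⟨m, hm⟩ : ∃ m, Nat.find hex = m + 1 := by
    refine Nat.exists_eq_succ_of_ne_zero fun h => ?_
    have := Nat.find_spec hex
    simp [h, hc₀.ne'] at this
  refine ⟨m, not_le.mp (Nat.find_min hex (by omega)), ?_⟩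
  simpa [hm, Nat.lt_succ_iff] using Nat.find_spec hex

/-- Finite-precision EMX is provably learnable: for any coarse-graining `π : X → Y` with
countable `Y`, the class `ℱ_fin^{(π)}` is `(1/3, 1/3)`-learnable under the access model
that reveals only the discretized samples `π(x)`. -/
theorem finite_precision_emx_learnable {X Y : Type*} [Countable Y] (π : X → Y) :
    ∃ (d : ℕ) (G : (Fin d → Y) → Set X), (∀ T, G T ∈ finPrecisionClass π) ∧
      ∀ P : PMF X, P.support.Finite →
        (2/3 : ℝ≥0∞) ≤ iidProb P
          {S : Fin d → X |
            optFam (finPrecisionClass π) P - 1/3 ≤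
              P.toOuterMeasure (G (fun j => π (S j)))} := by
  obtain ⟨e, he⟩ := exists_injective_nat Y
  refine ⟨3, fun T => π ⁻¹' {y | ∃ j, e y ≤ e (T j)}, fun T => ?_, fun P hP => ?_⟩
  · have hfin : {y | ∃ j, e y ≤ e (T j)}.Finite := by
      rw [Set.ofPred_exists]
      exact Set.finite_iUnion fun j => (Set.finite_Iic (e (T j))).preimage he.injOn
    exact ⟨hfin.toFinset, by rw [hfin.coe_toFinset]⟩
  obtain ⟨m, hlt, hle⟩ := P.exists_quantile hP (fun x => e (π x)) (c := 2 / 3)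
    (ENNReal.div_pos (by norm_num) (by norm_num)) (ENNReal.div_le_of_le_mul (by norm_num))
  have hsum : (2 / 3 + 1 / 3 : ℝ≥0∞) = 1 := by
    rw [ENNReal.div_add_div_same, two_add_one_eq_three]
    exact ENNReal.div_self (by norm_num) (by norm_num)
  set B : Set X := {x | e (π x) < m}
  refine le_trans ?_ (iidProb_mono P (E := {S : Fin 3 → X | ∀ j, S j ∈ B}ᶜ) fun S hS => ?_)
  · have hadd := iidProb_add_compl P {S : Fin 3 → X | ∀ j, S j ∈ B}
    rw [iidProb_forall_mem] at hadd
    have hcube : P.toOuterMeasure B ^ 3 ≤ 1 / 3 := by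
      refine (pow_le_pow_left' hlt.le 3).trans ?_
      rw [← ENNReal.toReal_le_toReal (by finiteness) (by finiteness)]
      norm_num [ENNReal.toReal_div]
    refine (ENNReal.add_le_add_iff_left (a := 1 / 3) (by finiteness)).mp ?_
    rw [add_comm, hsum]
    exact hadd.ge.trans (by gcongr)
  · obtain ⟨j, hj⟩ := not_forall.mp hS
    refine tsub_le_iff_right.mpr ((optFam_le_one _ P).trans ?_)
    refine hsum.ge.trans ?_
    gcongr
    refine hle.trans (P.toOuterMeasure.mono fun x hx => ⟨j, ?_⟩)
    exact le_trans hx (not_lt.mp hj)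
end
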